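/- arXiv:math/0405001 — 2 statements merged into one kernel-verified Lean document; each statement's English description precedes it below -/
import Mathlib

section
/- For every integer r ≥ 2, every real p > 0 and every integer n ≥ 1, φ(r,p,n) ≤ (r/(p+1)) · (p/(p+1))^p · n^{p+1}. -/
open Finset

/-- `f(p,G)`: the sum of the `p`-th powers of the vertex degrees of `G`. -/
noncomputable def degPowerSum (p : ℝ) {V : Type*} [Fintype V] (G : SimpleGraph V) : ℝ :=
  letI := Classical.decRel G.Adj
  ∑ u, (G.degree u : ℝ) ^ p

/-- `φ(r,p,n)`: the maximum of `f(p,G)` over `K_{r+1}`-free graphs on `n` vertices. -/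
noncomputable def phiClique (r : ℕ) (p : ℝ) (n : ℕ) : ℝ :=
  sSup {x | ∃ G : SimpleGraph (Fin n), G.CliqueFree (r + 1) ∧ x = degPowerSum p G}

/-- A clique-free set of vertices can be coloured so that each vertex has at most as many
neighbours as there are vertices outside its colour class. -/
theorem exists_coloring_degree_add_card_le {V : Type*} [DecidableEq V] (G : SimpleGraph V)
    [DecidableRel G.Adj] (r : ℕ) :
    ∀ S : Finset V, G.CliqueFreeOn S (r + 1) → ∃ c : V → ℕ, ∀ u ∈ S, c u < r ∧
      #{w ∈ S | G.Adj u w} + #{w ∈ S | c w = c u} ≤ #S := by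
  induction r with
  | zero =>
    intro S hS
    refine ⟨fun _ => 0, fun u hu => ?_⟩
    exact absurd (SimpleGraph.isNClique_one.2 ⟨u, rfl⟩) (hS (t := {u}) (by simpa using hu))
  | succ r ih =>
    intro S hS
    rcases S.eq_empty_or_nonempty with rfl | hne
    · exact ⟨fun _ => 0, by simp⟩
    obtain ⟨v, hv, hmax⟩ := S.exists_max_image (fun u => #{w ∈ S | G.Adj u w}) hne
    obtain ⟨c, hc⟩ := ih {w ∈ S | G.Adj v w} (by
      have := hS.of_succ G (mem_coe.2 hv)
      convert this using 1
      ext w; simp)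
    set T : Finset V := {w ∈ S | G.Adj v w} with hT
    have hTS : T ⊆ S := filter_subset _ _
    have hcard : #(S \ T) + #T = #S := card_sdiff_add_card_eq_card hTS
    refine ⟨fun u => if u ∈ T then c u else r, fun u hu => ?_⟩
    by_cases huT : u ∈ T
    · obtain ⟨hlt, hle⟩ := hc u huT
      refine ⟨by simp only [huT, if_true]; omega, ?_⟩
      have h₁ : #{w ∈ S | G.Adj u w} ≤ #{w ∈ T | G.Adj u w} + #(S \ T) := by
        refine (card_le_card ?_).trans (card_union_le _ _)
        intro w
        simp only [mem_filter, mem_union, mem_sdiff]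
        tauto
      have h₂ : #{w ∈ S | (if w ∈ T then c w else r) = if u ∈ T then c u else r} ≤
          #{w ∈ T | c w = c u} := by
        refine card_le_card fun w => ?_
        simp only [mem_filter, huT, if_true]
        rintro ⟨-, h⟩
        split_ifs at h with hw
        · exact ⟨hw, h⟩
        · omega
      dsimp only
      omega
    · refine ⟨by simp [huT], ?_⟩
      have h₁ : #{w ∈ S | G.Adj u w} ≤ #T := hmax u hu
      have h₂ : #{w ∈ S | (if w ∈ T then c w else r) = if u ∈ T then c u else r} ≤
          #(S \ T) := by
        refine card_le_card fun w => ?_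
        simp only [mem_filter, huT, if_false, mem_sdiff]
        rintro ⟨hwS, h⟩
        refine ⟨hwS, fun hw => ?_⟩
        rw [if_pos hw] at h
        have := (hc w hw).1
        omega
      dsimp only
      omega

theorem mul_sub_rpow_le {p x y : ℝ} (hp : 0 < p) (hx : 0 ≤ x) (hxy : x ≤ y) :
    x * (y - x) ^ p ≤ 1 / (p + 1) * (p / (p + 1)) ^ p * y ^ (p + 1) := by
  have hq : 0 < p + 1 := by linarith
  have hz : 0 ≤ (y - x) / p := div_nonneg (by linarith) hp.le
  have hy : 0 ≤ y := hx.trans hxy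
  have amgm := Real.geom_mean_le_arith_mean2_weighted (w₁ := 1 / (p + 1)) (w₂ := p / (p + 1))
    (by positivity) (by positivity) hx hz (by field_simp; ring)
  have hmean : 1 / (p + 1) * x + p / (p + 1) * ((y - x) / p) = y / (p + 1) := by
    field_simp; ring
  rw [hmean] at amgm
  have h := Real.rpow_le_rpow (by positivity) amgm hq.le
  rw [Real.mul_rpow (by positivity) (by positivity), ← Real.rpow_mul hx, ← Real.rpow_mul hz,
    div_mul_cancel₀ _ hq.ne', div_mul_cancel₀ _ hq.ne', Real.rpow_one,
    Real.div_rpow (by linarith) hp.le, Real.div_rpow hy hq.le, Real.rpow_add_one hq.ne'] at h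
  have hpp : 0 < p ^ p := Real.rpow_pos_of_pos hp p
  have hqp : 0 < (p + 1) ^ p := Real.rpow_pos_of_pos hq p
  rw [Real.div_rpow hp.le hq.le]
  calc x * (y - x) ^ p = p ^ p * (x * ((y - x) ^ p / p ^ p)) := by field_simp
    _ ≤ p ^ p * (y ^ (p + 1) / ((p + 1) ^ p * (p + 1))) := by gcongr
    _ = _ := by field_simp

theorem degPowerSum_le_of_cliqueFree {r n : ℕ} {p : ℝ} (hp : 0 < p) (G : SimpleGraph (Fin n))
    (hG : G.CliqueFree (r + 1)) :
    degPowerSum p G ≤ (r / (p + 1)) * (p / (p + 1)) ^ p * (n : ℝ) ^ (p + 1) := by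
  classical
  obtain ⟨c, hc⟩ := exists_coloring_degree_add_card_le G r univ hG.cliqueFreeOn
  set k : ℕ → ℕ := fun i => #{w : Fin n | c w = i} with hk
  have hkn (i : ℕ) : (k i : ℝ) ≤ n := by
    exact_mod_cast (card_filter_le _ _).trans_eq (card_fin n)
  calc degPowerSum p G ≤ ∑ u, ((n : ℝ) - k (c u)) ^ p := by
        unfold degPowerSum
        refine sum_le_sum fun u _ => Real.rpow_le_rpow (by positivity) ?_ hp.le
        have h := (hc u (mem_univ u)).2
        rw [card_fin, ← SimpleGraph.neighborFinset_eq_filter,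
          SimpleGraph.card_neighborFinset_eq_degree] at h
        have h' : (G.degree u : ℝ) + k (c u) ≤ n := by exact_mod_cast h
        convert le_sub_iff_add_le.2 h'
    _ = ∑ i ∈ range r, (k i : ℝ) * ((n : ℝ) - k i) ^ p := by
        rw [← sum_fiberwise_of_maps_to (g := c) (t := range r)
          fun u _ => mem_range.2 (hc u (mem_univ u)).1]
        refine sum_congr rfl fun i _ => ?_
        rw [sum_congr rfl (g := fun _ => ((n : ℝ) - k i) ^ p)
          fun u hu => by rw [(mem_filter.1 hu).2], sum_const, nsmul_eq_mul]
    _ ≤ ∑ _i ∈ range r, 1 / (p + 1) * (p / (p + 1)) ^ p * (n : ℝ) ^ (p + 1) :=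
        sum_le_sum fun i _ => mul_sub_rpow_le hp (by positivity) (hkn i)
    _ = _ := by
        rw [sum_const, card_range, nsmul_eq_mul]
        ring

theorem stmt3 (r : ℕ) (hr : 2 ≤ r) (p : ℝ) (hp : 0 < p) (n : ℕ) (hn : 1 ≤ n) :
    phiClique r p n ≤ (r / (p + 1)) * (p / (p + 1)) ^ p * (n : ℝ) ^ (p + 1) := by
  refine Real.sSup_le ?_ (by positivity)
  rintro _ ⟨G, hG, rfl⟩
  exact degPowerSum_le_of_cliqueFree hp G hG
end

section
/- Let r ≥ 2 be an integer, let H be a finite simple graph with chromatic number r + 1, and let p > 0 be real. Then φ(H,p,n) = φ(r,p,n) + o(n^{p+1}) as n → ∞; that is, (φ(H,p,n) − φ(r,p,n)) / n^{p+1} → 0. -/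
open Finset

/-- `G` contains a subgraph isomorphic to `H`. -/
def Contains {α β : Type*} (G : SimpleGraph α) (H : SimpleGraph β) : Prop :=
  ∃ f : H →g G, Function.Injective f

/-- `φ(H,p,n)`: the maximum of `f(p,G)` over `H`-free graphs on `n` vertices. -/
noncomputable def phiForb {W : Type*} [Fintype W] (H : SimpleGraph W) (p : ℝ) (n : ℕ) : ℝ :=
  sSup {x | ∃ G : SimpleGraph (Fin n), ¬ Contains G H ∧ x = degPowerSum p G}

open scoped BigOperators

/-- Restricting a uniformly random function along an injection gives a uniformly random
function. -/
lemma expect_comp_injective {ι κ V : Type*} [Fintype ι] [Fintype κ] [Fintype V] [Nonempty V]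
    [DecidableEq ι] [DecidableEq κ] {φ : ι → κ} (hφ : Function.Injective φ)
    (F : (ι → V) → ℝ) : 𝔼 x : κ → V, F (x ∘ φ) = 𝔼 y : ι → V, F y := by
  classical
  rw [Fintype.expect_equiv (Equiv.piEquivPiSubtypeProd (· ∈ Set.range φ) (fun _ => V))
    (fun x => F (x ∘ φ)) (fun z => F (fun i => z.1 ⟨φ i, i, rfl⟩)) (fun x => rfl),
    ← Finset.univ_product_univ, Finset.expect_product]
  simp only [Fintype.expect_const]
  refine Fintype.expect_equiv ((Equiv.ofInjective φ hφ).arrowCongr (Equiv.refl V)).symm _ _ ?_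
  intro x
  rfl

/-- Averaging over random functions is unchanged when one coordinate is resampled. -/
lemma expect_update {κ V : Type*} [Fintype κ] [Fintype V] [Nonempty V] [DecidableEq κ] (j : κ)
    (F : (κ → V) → ℝ) :
    𝔼 x : κ → V, 𝔼 v, F (Function.update x j v) = 𝔼 x : κ → V, F x := by
  have key (G : (κ → V) → ℝ) := Fintype.expect_equiv (Equiv.funSplitAt j V) G
    (fun z => G ((Equiv.funSplitAt j V).symm z)) (fun x => by rw [Equiv.symm_apply_apply])
  rw [key F, key, ← Finset.univ_product_univ, Finset.expect_product, Finset.expect_product]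
  have (a b : V) (y : {k // k ≠ j} → V) :
      Function.update ((Equiv.funSplitAt j V).symm (a, y)) j b =
        (Equiv.funSplitAt j V).symm (b, y) := by
    ext k
    by_cases h : k = j
    · subst h; simp
    · simp [h]
  simp only [this, Fintype.expect_const]
  exact Finset.expect_comm _ _ _

lemma expect_ite_apply_eq {κ V : Type*} [Fintype κ] [Fintype V] [Nonempty V] [DecidableEq κ]
    [DecidableEq V] {i j : κ} (hij : i ≠ j) :
    𝔼 x : κ → V, (if x i = x j then (1 : ℝ) else 0) = (Fintype.card V : ℝ)⁻¹ := by
  rw [← expect_update j]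
  simp [hij]

open Classical in
lemma expect_not_injective_le {κ V : Type*} [Fintype κ] [Fintype V] [Nonempty V] :
    𝔼 x : κ → V, (if Function.Injective x then (0 : ℝ) else 1) ≤
      (Fintype.card κ : ℝ) ^ 2 / Fintype.card V := by
  calc 𝔼 x : κ → V, (if Function.Injective x then (0 : ℝ) else 1)
      ≤ 𝔼 x : κ → V, ∑ q : κ × κ, if q.1 ≠ q.2 then (if x q.1 = x q.2 then (1 : ℝ) else 0)
          else 0 := by
        refine Finset.expect_le_expect fun x _ => ?_
        have hnn (q : κ × κ) : (0 : ℝ) ≤ if q.1 ≠ q.2 then (if x q.1 = x q.2 then (1 : ℝ) else 0)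
          else 0 := by split_ifs <;> simp
        split_ifs with h
        · exact Finset.sum_nonneg fun q _ => hnn q
        · obtain ⟨a, b, hab, hne⟩ := by simpa [Function.Injective] using h
          refine le_trans ?_ (Finset.single_le_sum (fun q _ => hnn q) (Finset.mem_univ (a, b)))
          simp [hab, hne]
    _ = ∑ q : κ × κ, if q.1 ≠ q.2 then (Fintype.card V : ℝ)⁻¹ else 0 := by
        rw [Finset.expect_sum_comm]
        refine Finset.sum_congr rfl fun q _ => ?_
        split_ifs with h
        · exact expect_ite_apply_eq h
        · simp
    _ ≤ ∑ q : κ × κ, (Fintype.card V : ℝ)⁻¹ := by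
        refine Finset.sum_le_sum fun q _ => ?_
        split_ifs <;> simp
    _ = (Fintype.card κ : ℝ) ^ 2 / Fintype.card V := by
        simp [Fintype.card_prod]
        ring

/-- The degree of `v` in the weighted graph `w`, normalised by the number of vertices. -/
noncomputable def weightDegree {V : Type*} [Fintype V] (w : V → V → ℝ) (v : V) : ℝ :=
  𝔼 u, w v u

lemma weightDegree_mem_Icc {V : Type*} [Fintype V] [Nonempty V] {w : V → V → ℝ}
    (h : ∀ u v, w u v ∈ Set.Icc 0 1) (v : V) : weightDegree w v ∈ Set.Icc 0 1 :=
  ⟨Finset.expect_nonneg fun u _ => (h v u).1,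
    Finset.expect_le Finset.univ_nonempty fun u _ => (h v u).2⟩

/-- The degree of a vertex in a random sample has small variance. -/
lemma expect_sq_weightDegree_sub_le {κ V : Type*} [Fintype κ] [Fintype V] [Nonempty V]
    [DecidableEq κ] {w : V → V → ℝ} (h : ∀ u v, w u v ∈ Set.Icc 0 1) (i : κ) :
    𝔼 x : κ → V, (weightDegree (fun a b => w (x a) (x b)) i - weightDegree w (x i)) ^ 2 ≤
      (Fintype.card κ : ℝ)⁻¹ := by
  have : Nonempty κ := ⟨i⟩
  set b : V → V → ℝ := fun u v => w u v - weightDegree w u with hb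
  have hb0 (u : V) : 𝔼 v, b u v = 0 := by
    simp [hb, Finset.expect_sub_distrib, weightDegree]
  have hb1 (u v : V) : b u v * b u v ≤ 1 := by
    have h1 := h u v
    have h2 := weightDegree_mem_Icc h u
    simp only [hb, Set.mem_Icc] at *
    nlinarith
  have hzero (j k : κ) (hij : j ≠ i) (hjk : j ≠ k) :
      𝔼 x : κ → V, b (x i) (x j) * b (x i) (x k) = 0 := by
    rw [← expect_update j]
    refine Finset.expect_eq_zero fun x _ => ?_
    simp only [Function.update_self, Function.update_of_ne hij.symm,
      Function.update_of_ne hjk.symm, ← Finset.expect_mul, hb0, zero_mul]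
  have hpair (j k : κ) : 𝔼 x : κ → V, b (x i) (x j) * b (x i) (x k) ≤ if j = k then 1 else 0 := by
    split_ifs with hjk
    · subst hjk
      exact Finset.expect_le Finset.univ_nonempty fun x _ => hb1 _ _
    · by_cases hij : j = i
      · rw [Finset.expect_congr rfl fun x _ => mul_comm (b (x i) (x j)) (b (x i) (x k))]
        exact (hzero k j (fun h => hjk (hij.trans h.symm)) (Ne.symm hjk)).le
      · exact (hzero j k hij hjk).le
  calc _ = 𝔼 x : κ → V, 𝔼 j, 𝔼 k, b (x i) (x j) * b (x i) (x k) := by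
        refine Finset.expect_congr rfl fun x _ => ?_
        have : weightDegree (fun a b => w (x a) (x b)) i - weightDegree w (x i) =
            𝔼 j, b (x i) (x j) := by
          simp [hb, Finset.expect_sub_distrib, weightDegree]
        rw [this, sq, Finset.expect_mul_expect]
    _ = 𝔼 j, 𝔼 k, 𝔼 x : κ → V, b (x i) (x j) * b (x i) (x k) := by
        rw [Finset.expect_comm]
        exact Finset.expect_congr rfl fun j _ => Finset.expect_comm _ _ _
    _ ≤ 𝔼 j : κ, 𝔼 k : κ, if j = k then (1 : ℝ) else 0 :=
        Finset.expect_le_expect fun j _ => Finset.expect_le_expect fun k _ => hpair j k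
    _ = (Fintype.card κ : ℝ)⁻¹ := by
        simp

/-- The average `p`-th power of the normalised degrees. -/
noncomputable def meanDegreePow (p : ℝ) {V : Type*} [Fintype V] (w : V → V → ℝ) : ℝ :=
  𝔼 v, weightDegree w v ^ p

lemma meanDegreePow_mem_Icc {p : ℝ} (hp : 0 < p) {V : Type*} [Fintype V] [Nonempty V]
    {w : V → V → ℝ} (h : ∀ u v, w u v ∈ Set.Icc 0 1) : meanDegreePow p w ∈ Set.Icc 0 1 :=
  ⟨Finset.expect_nonneg fun v _ => Real.rpow_nonneg (weightDegree_mem_Icc h v).1 _,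
    Finset.expect_le Finset.univ_nonempty fun v _ =>
      Real.rpow_le_one (weightDegree_mem_Icc h v).1 (weightDegree_mem_Icc h v).2 hp.le⟩

lemma exists_rpow_le_rpow_add {p : ℝ} (hp : 0 < p) {ε : ℝ} (hε : 0 < ε) :
    ∃ C : ℝ, 0 ≤ C ∧ ∀ a ∈ Set.Icc (0 : ℝ) 1, ∀ b ∈ Set.Icc (0 : ℝ) 1,
      a ^ p ≤ b ^ p + ε + C * (b - a) ^ 2 := by
  have huc : UniformContinuousOn (fun t : ℝ => t ^ p) (Set.Icc 0 1) :=
    isCompact_Icc.uniformContinuousOn_of_continuous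
      (Real.continuous_rpow_const hp.le).continuousOn
  obtain ⟨δ, hδ, hd⟩ := Metric.uniformContinuousOn_iff.1 huc ε hε
  refine ⟨1 / δ ^ 2, by positivity, fun a ha b hb => ?_⟩
  rcases lt_or_ge (dist a b) δ with hlt | hge
  · have h1 := hd a ha b hb hlt
    rw [Real.dist_eq] at h1
    have h2 := (abs_lt.1 h1).2
    have h3 : 0 ≤ 1 / δ ^ 2 * (b - a) ^ 2 := by positivity
    linarith
  · have h1 : 1 ≤ 1 / δ ^ 2 * (b - a) ^ 2 := by
      rw [one_div_mul_eq_div, one_le_div (by positivity), ← sq_abs (b - a), abs_sub_comm]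
      rw [Real.dist_eq] at hge
      gcongr
    have h2 := Real.rpow_le_one ha.1 ha.2 hp.le
    have h3 := Real.rpow_nonneg hb.1 p
    linarith

/-- Random samples do not decrease `meanDegreePow` by much, on average. -/
lemma exists_meanDegreePow_le_expect {p : ℝ} (hp : 0 < p) {ε : ℝ} (hε : 0 < ε) :
    ∃ C : ℝ, 0 ≤ C ∧ ∀ (n m : ℕ), 0 < n → 0 < m → ∀ w : Fin n → Fin n → ℝ,
      (∀ u v, w u v ∈ Set.Icc 0 1) →
      meanDegreePow p w ≤
        𝔼 x : Fin m → Fin n, meanDegreePow p (fun a b => w (x a) (x b)) + ε + C / m := by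
  obtain ⟨C, hC, hCp⟩ := exists_rpow_le_rpow_add hp hε
  refine ⟨C, hC, fun n m hn hm w hw => ?_⟩
  have : Nonempty (Fin n) := ⟨⟨0, hn⟩⟩
  have : Nonempty (Fin m) := ⟨⟨0, hm⟩⟩
  have hi (i : Fin m) : meanDegreePow p w ≤
      𝔼 x : Fin m → Fin n, weightDegree (fun a b => w (x a) (x b)) i ^ p + ε + C / m := by
    have hmarg : meanDegreePow p w = 𝔼 x : Fin m → Fin n, weightDegree w (x i) ^ p := by
      rw [← expect_update i]
      simp [meanDegreePow]
    calc meanDegreePow p w = 𝔼 x : Fin m → Fin n, weightDegree w (x i) ^ p := hmarg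
      _ ≤ 𝔼 x : Fin m → Fin n, (weightDegree (fun a b => w (x a) (x b)) i ^ p + ε +
          C * (weightDegree (fun a b => w (x a) (x b)) i - weightDegree w (x i)) ^ 2) :=
        Finset.expect_le_expect fun x _ => hCp _ (weightDegree_mem_Icc hw _) _
          (weightDegree_mem_Icc (fun _ _ => hw _ _) _)
      _ ≤ _ := by
        rw [Finset.expect_add_distrib, Finset.expect_add_distrib, Fintype.expect_const,
          ← Finset.mul_expect, div_eq_mul_inv]
        have := expect_sq_weightDegree_sub_le hw i
        rw [Fintype.card_fin] at this
        gcongr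
  calc meanDegreePow p w = 𝔼 _i : Fin m, meanDegreePow p w := (Fintype.expect_const _).symm
    _ ≤ 𝔼 i : Fin m, (𝔼 x : Fin m → Fin n, weightDegree (fun a b => w (x a) (x b)) i ^ p
        + ε + C / m) := Finset.expect_le_expect fun i _ => hi i
    _ = _ := by
        rw [Finset.expect_add_distrib, Finset.expect_add_distrib, Fintype.expect_const,
          Fintype.expect_const, Finset.expect_comm]
        rfl

open Classical in
/-- A dense `k`-ary relation contains a large box. -/
lemma exists_box_of_dense (t : ℕ) : ∀ (k : ℕ) {δ : ℝ}, 0 < δ → ∃ N : ℕ, ∀ n ≥ N, 0 < n →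
    ∀ R : (Fin k → Fin n) → Prop,
      δ ≤ 𝔼 y : Fin k → Fin n, (if R y then (1 : ℝ) else 0) →
      ∃ f : Fin k → Fin t → Fin n, (∀ i, Function.Injective (f i)) ∧
        ∀ g : Fin k → Fin t, R fun i => f i (g i)
  | 0, δ, hδ => by
    refine ⟨0, fun n _ _ R hR => ⟨fun i => i.elim0, fun i => i.elim0, fun g => ?_⟩⟩
    by_contra hcon
    have h0 : 𝔼 y : Fin 0 → Fin n, (if R y then (1 : ℝ) else 0) = 0 :=
      Finset.expect_eq_zero fun y _ => if_neg (by rwa [Subsingleton.elim y])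
    linarith
  | k + 1, δ, hδ => by
    have hδt : 0 < δ ^ t := by positivity
    obtain ⟨N, hN⟩ := exists_box_of_dense t k (half_pos hδt)
    obtain ⟨M, hM⟩ := exists_nat_gt ((t : ℝ) ^ 2 / (δ ^ t / 2))
    refine ⟨max N M, fun n hn hn0 R hR => ?_⟩
    have : Nonempty (Fin n) := ⟨⟨0, hn0⟩⟩
    have hsmall : (t : ℝ) ^ 2 / n < δ ^ t / 2 := by
      have hMn : (M : ℝ) ≤ n := by exact_mod_cast (le_max_right N M).trans hn
      rw [div_lt_iff₀ (by positivity)] at hM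
      rw [div_lt_iff₀ (by positivity)]
      nlinarith
    set F : (Fin k → Fin n) → ℝ :=
      fun y => 𝔼 v : Fin n, if R (Fin.cons v y) then (1 : ℝ) else 0 with hF
    have hF0 (y) : 0 ≤ F y := Finset.expect_nonneg fun v _ => by split_ifs <;> simp
    have hFR : 𝔼 y, F y = 𝔼 y : Fin (k + 1) → Fin n, (if R y then (1 : ℝ) else 0) := by
      rw [hF, Finset.expect_comm, ← Finset.expect_product', Finset.univ_product_univ]
      exact Fintype.expect_equiv (Fin.consEquiv fun _ => Fin n) _ _ fun z => rfl
    have hpow (y) : F y ^ t =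
        𝔼 g : Fin t → Fin n, if ∀ i, R (Fin.cons (g i) y) then (1 : ℝ) else 0 := by
      rw [hF, Finset.expect_pow, Fintype.piFinset_univ]
      refine Finset.expect_congr rfl fun g _ => ?_
      rw [Finset.prod_boole]
      simp
    have hjensen : δ ^ t ≤ 𝔼 y, F y ^ t := by
      have h1 := Real.pow_arith_mean_le_arith_mean_pow Finset.univ
        (fun _ : Fin k → Fin n => (Fintype.card (Fin k → Fin n) : ℝ)⁻¹) F
        (fun _ _ => by positivity)
        (by simp [-Fintype.card_pi, Fintype.card_ne_zero]) (fun y _ => hF0 y) t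
      rw [← Finset.mul_sum, ← Finset.mul_sum, inv_mul_eq_div, inv_mul_eq_div,
        ← Fintype.expect_eq_sum_div_card, ← Fintype.expect_eq_sum_div_card, hFR] at h1
      exact (pow_le_pow_left₀ hδ.le hR t).trans h1
    obtain ⟨g, hg, hgd⟩ : ∃ g : Fin t → Fin n, Function.Injective g ∧ δ ^ t / 2 ≤
        𝔼 y : Fin k → Fin n, if ∀ i, R (Fin.cons (g i) y) then (1 : ℝ) else 0 := by
      by_contra! hcon
      have hle : 𝔼 y, F y ^ t ≤
          𝔼 g : Fin t → Fin n, ((if Function.Injective g then (0 : ℝ) else 1) + δ ^ t / 2) := by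
        simp_rw [hpow]
        rw [Finset.expect_comm]
        refine Finset.expect_le_expect fun g _ => ?_
        split_ifs with hg
        · rw [zero_add]; exact (hcon g hg).le
        · have : 𝔼 y : Fin k → Fin n,
              (if ∀ i, R (Fin.cons (g i) y) then (1 : ℝ) else 0) ≤ 1 :=
            Finset.expect_le Finset.univ_nonempty fun y _ => by split_ifs <;> simp
          linarith
      rw [Finset.expect_add_distrib, Fintype.expect_const] at hle
      have h2 : 𝔼 g : Fin t → Fin n, (if Function.Injective g then (0 : ℝ) else 1) ≤
          (t : ℝ) ^ 2 / n := by
        convert expect_not_injective_le (κ := Fin t) (V := Fin n) <;> simp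
      linarith
    obtain ⟨f, hf, hfR⟩ := hN n ((le_max_left N M).trans hn) hn0
      (fun y => ∀ i, R (Fin.cons (g i) y)) (by convert hgd)
    refine ⟨Fin.cons g f, fun i => ?_, fun e => ?_⟩
    · cases i using Fin.cases with
      | zero => simpa using hg
      | succ i => simpa using hf i
    · convert hfR (fun i => e i.succ) (e 0) using 1
      ext i
      cases i using Fin.cases <;> simp

/-- The indicator function of adjacency. -/
noncomputable def adjWeight {V : Type*} (G : SimpleGraph V) (u v : V) : ℝ :=
  open Classical in if G.Adj u v then 1 else 0

lemma adjWeight_mem_Icc {V : Type*} (G : SimpleGraph V) (u v : V) :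
    adjWeight G u v ∈ Set.Icc 0 1 := by
  unfold adjWeight
  split_ifs <;> simp

lemma meanDegreePow_adjWeight (p : ℝ) {n : ℕ} (hn : 0 < n)
    (G : SimpleGraph (Fin n)) :
    meanDegreePow p (adjWeight G) = degPowerSum p G / (n : ℝ) ^ (p + 1) := by
  classical
  have hn' : (0 : ℝ) < n := by exact_mod_cast hn
  have hdeg (u : Fin n) : weightDegree (adjWeight G) u = (G.degree u : ℝ) / n := by
    rw [weightDegree, Fintype.expect_eq_sum_div_card, Fintype.card_fin,
      ← SimpleGraph.card_neighborFinset_eq_degree, SimpleGraph.neighborFinset_eq_filter]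
    simp [adjWeight]
  rw [meanDegreePow, Fintype.expect_eq_sum_div_card, Fintype.card_fin,
    Real.rpow_add hn', Real.rpow_one, ← div_div, div_left_inj' hn'.ne', degPowerSum, Finset.sum_div]
  refine Finset.sum_congr rfl fun u _ => ?_
  rw [hdeg, Real.div_rpow (by positivity) hn'.le]

/-- Every `K_{r+1}`-free graph is dominated, degree by degree, by a complete `r`-partite graph. -/
lemma exists_coloring_degree_le {V : Type*} [Fintype V] [DecidableEq V] (G : SimpleGraph V)
    [DecidableRel G.Adj] : ∀ (r : ℕ) (S : Finset V), G.CliqueFreeOn S (r + 1) →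
      ∃ c : V → ℕ, (∀ v ∈ S, c v < r) ∧
        ∀ u ∈ S, #{v ∈ S | G.Adj u v} ≤ #{v ∈ S | c u ≠ c v}
  | 0, S, hS => by
    have hempty : S = ∅ := by
      by_contra hne
      obtain ⟨v, hv⟩ := Finset.nonempty_iff_ne_empty.2 hne
      exact hS (t := {v}) (by simpa using hv) (by simp)
    subst hempty
    exact ⟨fun _ => 0, by simp, by simp⟩
  | r + 1, S, hS => by
    rcases S.eq_empty_or_nonempty with rfl | hne
    · exact ⟨fun _ => 0, by simp, by simp⟩
    obtain ⟨x, hx, hmax⟩ := S.exists_max_image (fun u => #{v ∈ S | G.Adj u v}) hne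
    set A := S.filter (G.Adj x) with hA
    have hAfree : G.CliqueFreeOn A (r + 1) := by
      have h := SimpleGraph.CliqueFreeOn.of_succ G hS (Finset.mem_coe.2 hx)
      refine SimpleGraph.CliqueFreeOn.subset G (fun v hv => ?_) h
      simpa [hA] using hv
    obtain ⟨c, hc, hcd⟩ := exists_coloring_degree_le G r A hAfree
    refine ⟨fun v => if v ∈ A then c v else r, fun v _ => ?_, fun u hu => ?_⟩
    · dsimp only
      split_ifs with hv
      · exact (hc v hv).trans (Nat.lt_succ_self r)
      · exact Nat.lt_succ_self r
    · by_cases huA : u ∈ A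
      · have hsplit (P : V → Prop) [DecidablePred P] :
            #(S.filter P) = #(A.filter P) + #((S \ A).filter P) := by
          rw [← Finset.card_union_of_disjoint, ← Finset.filter_union,
            Finset.union_sdiff_of_subset (Finset.filter_subset _ _)]
          exact Finset.disjoint_filter_filter Finset.disjoint_sdiff
        rw [hsplit, hsplit]
        refine Nat.add_le_add ((hcd u huA).trans (Finset.card_le_card fun v hv => ?_))
          (Finset.card_le_card fun v hv => ?_)
        · rw [Finset.mem_filter] at hv ⊢
          simpa [huA, hv.1] using hv.2
        · rw [Finset.mem_filter] at hv ⊢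
          refine ⟨hv.1, ?_⟩
          simp only [huA, (Finset.mem_sdiff.1 hv.1).2, if_true, if_false]
          exact (hc u huA).ne
      · refine (hmax u hu).trans (Finset.card_le_card fun v hv => ?_)
        have hv' : v ∈ A := hv
        rw [Finset.mem_filter] at hv ⊢
        refine ⟨hv.1, ?_⟩
        simp only [huA, hv', if_true, if_false]
        exact (hc v hv').ne'

lemma degPowerSum_le {p : ℝ} (hp : 0 < p) {n : ℕ} (G : SimpleGraph (Fin n)) :
    degPowerSum p G ≤ (n : ℝ) ^ (p + 1) := by
  rcases n.eq_zero_or_pos with rfl | hn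
  · simp only [degPowerSum, Finset.univ_eq_empty, Finset.sum_empty]
    positivity
  · have : Nonempty (Fin n) := ⟨⟨0, hn⟩⟩
    have h := (meanDegreePow_mem_Icc hp (adjWeight_mem_Icc G)).2
    rwa [meanDegreePow_adjWeight p hn, div_le_one (by positivity)] at h

lemma degPowerSum_nonneg (p : ℝ) {n : ℕ} (G : SimpleGraph (Fin n)) : 0 ≤ degPowerSum p G :=
  Finset.sum_nonneg fun _ _ => by positivity

lemma degPowerSum_le_phiClique {r n : ℕ} {p : ℝ} (hp : 0 < p) {G : SimpleGraph (Fin n)}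
    (hG : G.CliqueFree (r + 1)) : degPowerSum p G ≤ phiClique r p n :=
  le_csSup ⟨(n : ℝ) ^ (p + 1), by rintro _ ⟨G, _, rfl⟩; exact degPowerSum_le hp G⟩ ⟨G, hG, rfl⟩

lemma phiClique_nonneg (r : ℕ) (p : ℝ) (n : ℕ) : 0 ≤ phiClique r p n :=
  Real.sSup_nonneg (by rintro _ ⟨G, _, rfl⟩; exact degPowerSum_nonneg p G)

lemma phiClique_le_phiForb {r : ℕ} {W : Type*} [Fintype W] {H : SimpleGraph W}
    (hH : ¬ H.Colorable r) {p : ℝ} (hp : 0 < p) (n : ℕ) :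
    phiClique r p n ≤ phiForb H p n := by
  classical
  have hbdd : BddAbove {x | ∃ G : SimpleGraph (Fin n), ¬ Contains G H ∧ x = degPowerSum p G} :=
    ⟨(n : ℝ) ^ (p + 1), by rintro _ ⟨G, _, rfl⟩; exact degPowerSum_le hp G⟩
  refine Real.sSup_le ?_
    (Real.sSup_nonneg (by rintro _ ⟨G, _, rfl⟩; exact degPowerSum_nonneg p G))
  rintro _ ⟨G, hG, rfl⟩
  obtain ⟨c, hc, hcd⟩ := exists_coloring_degree_le G r Finset.univ hG.cliqueFreeOn
  refine le_trans ?_ (le_csSup hbdd ⟨(⊤ : SimpleGraph ℕ).comap c, ?_, rfl⟩)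
  · refine Finset.sum_le_sum fun u _ => Real.rpow_le_rpow (by positivity) ?_ hp.le
    have h := hcd u (Finset.mem_univ u)
    rw [← SimpleGraph.card_neighborFinset_eq_degree,
      ← SimpleGraph.card_neighborFinset_eq_degree, SimpleGraph.neighborFinset_eq_filter,
      SimpleGraph.neighborFinset_eq_filter]
    refine Nat.cast_le.2 ?_
    convert h
  · rintro ⟨f, -⟩
    refine hH ⟨SimpleGraph.Coloring.mk (fun w => (⟨c (f w), hc _ (Finset.mem_univ _)⟩ : Fin r)) ?_⟩
    intro v w hvw heq
    have h : c (f v) ≠ c (f w) := f.map_adj hvw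
    exact h (congrArg Fin.val heq)

/-- The proportion of `k`-tuples of vertices of `G` that span a clique. -/
noncomputable def cliqueDensity {V : Type*} [Fintype V] (k : ℕ) (G : SimpleGraph V) : ℝ :=
  open Classical in
  𝔼 y : Fin k → V, if ∀ i j, i ≠ j → G.Adj (y i) (y j) then (1 : ℝ) else 0

lemma exists_cliqueDensity_lt {k : ℕ} {W : Type*} [Fintype W] {H : SimpleGraph W}
    (hH : H.Colorable k) {η : ℝ} (hη : 0 < η) :
    ∃ N : ℕ, ∀ n ≥ N, 0 < n → ∀ G : SimpleGraph (Fin n), ¬ Contains G H →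
      cliqueDensity k G < η := by
  classical
  obtain ⟨c⟩ := hH
  obtain ⟨N, hN⟩ := exists_box_of_dense (Fintype.card W) k hη
  refine ⟨N, fun n hn hn0 G hG => ?_⟩
  by_contra! hcon
  obtain ⟨f, hf, hfR⟩ := hN n hn hn0 (fun y => ∀ i j, i ≠ j → G.Adj (y i) (y j))
    (hcon.trans_eq (by unfold cliqueDensity; congr!))
  let e := Fintype.equivFin W
  have hadj (v w : W) (hvw : c v ≠ c w) : G.Adj (f (c v) (e v)) (f (c w) (e w)) := by
    have h := hfR (fun i => if i = c v then e v else e w) (c v) (c w) hvw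
    simpa [hvw.symm] using h
  refine hG ⟨⟨fun v => f (c v) (e v), fun {v w} hvw => hadj v w (c.valid hvw)⟩, fun v w hvw => ?_⟩
  change f (c v) (e v) = f (c w) (e w) at hvw
  by_cases hc : c v = c w
  · rw [hc] at hvw
    exact e.injective (hf _ hvw)
  · exact absurd hvw (hadj v w hc).ne

/-- A random sample of a graph with few cliques is mostly clique-free. -/
lemma expect_meanDegreePow_le {r n m : ℕ} (hn : 0 < n) (hm : 0 < m) {p : ℝ} (hp : 0 < p)
    (G : SimpleGraph (Fin n)) :
    𝔼 x : Fin m → Fin n, meanDegreePow p (adjWeight (G.comap x)) ≤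
      phiClique r p m / (m : ℝ) ^ (p + 1) + (m : ℝ) ^ (r + 1) * cliqueDensity (r + 1) G := by
  classical
  have : Nonempty (Fin n) := ⟨⟨0, hn⟩⟩
  have : Nonempty (Fin m) := ⟨⟨0, hm⟩⟩
  let I : (Fin (r + 1) → Fin n) → ℝ :=
    fun y => if ∀ i j, i ≠ j → G.Adj (y i) (y j) then 1 else 0
  have hI (y) : 0 ≤ I y := by simp only [I]; split_ifs <;> simp
  have hIc : 𝔼 y, I y = cliqueDensity (r + 1) G := by
    unfold cliqueDensity
    congr!
  let T : (Fin m → Fin n) → (Fin (r + 1) → Fin m) → ℝ :=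
    fun x φ => if Function.Injective φ then I (x ∘ φ) else 0
  have hT (x φ) : 0 ≤ T x φ := by
    simp only [T]
    split_ifs
    exacts [hI _, le_rfl]
  have hx (x : Fin m → Fin n) : meanDegreePow p (adjWeight (G.comap x)) ≤
      phiClique r p m / (m : ℝ) ^ (p + 1) + ∑ φ, T x φ := by
    by_cases hfree : (G.comap x).CliqueFree (r + 1)
    · have h1 := degPowerSum_le_phiClique hp hfree
      rw [meanDegreePow_adjWeight p hm]
      have h2 : 0 ≤ ∑ φ, T x φ := Finset.sum_nonneg fun φ _ => hT x φ
      have h3 : degPowerSum p (G.comap x) / (m : ℝ) ^ (p + 1) ≤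
          phiClique r p m / (m : ℝ) ^ (p + 1) := by gcongr
      linarith
    · obtain ⟨φ⟩ := SimpleGraph.not_cliqueFree_iff_top_isContained (r + 1) |>.1 hfree
      have h1 : 1 ≤ ∑ φ, T x φ := by
        refine le_trans ?_ (Finset.single_le_sum (fun φ _ => hT x φ) (Finset.mem_univ ⇑φ))
        have : ∀ i j, i ≠ j → G.Adj ((x ∘ φ) i) ((x ∘ φ) j) := fun i j hij =>
          φ.toHom.map_adj hij
        have hφ : Function.Injective φ := φ.injective
        simp only [T, I, if_pos hφ, if_pos this, le_refl]
      have h2 := (meanDegreePow_mem_Icc hp (adjWeight_mem_Icc (G.comap x))).2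
      have h3 : 0 ≤ phiClique r p m / (m : ℝ) ^ (p + 1) :=
        div_nonneg (phiClique_nonneg r p m) (by positivity)
      linarith
  calc _ ≤ 𝔼 x : Fin m → Fin n, (phiClique r p m / (m : ℝ) ^ (p + 1) + ∑ φ, T x φ) :=
        Finset.expect_le_expect fun x _ => hx x
    _ = phiClique r p m / (m : ℝ) ^ (p + 1) + ∑ φ, 𝔼 x, T x φ := by
        rw [Finset.expect_add_distrib, Fintype.expect_const, Finset.expect_sum_comm]
    _ ≤ phiClique r p m / (m : ℝ) ^ (p + 1) +
        ∑ _φ : Fin (r + 1) → Fin m, cliqueDensity (r + 1) G := by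
        gcongr with φ
        by_cases hφ : Function.Injective φ
        · simp only [T, if_pos hφ]
          exact ((expect_comp_injective hφ I).trans hIc).le
        · simp only [T, if_neg hφ, Finset.expect_const_zero, ← hIc]
          exact Finset.expect_nonneg fun y _ => hI y
    _ = _ := by simp

lemma cliqueDensity_eq_zero {V : Type*} [Fintype V] {k : ℕ} {G : SimpleGraph V}
    (hG : G.CliqueFree k) : cliqueDensity k G = 0 := by
  classical
  refine Finset.expect_eq_zero fun y _ => if_neg fun hy => ?_
  refine (SimpleGraph.not_cliqueFree_iff_top_isContained k).2
    ⟨⟨⟨y, fun {i j} h => hy i j h⟩, fun i j hij => ?_⟩⟩ hG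
  by_contra hne
  exact (hy i j hne).ne hij

/-- Comparison of the normalised degree power of a graph with the extremal value for cliques on a
different number of vertices. -/
lemma exists_degPowerSum_le {r : ℕ} {p : ℝ} (hp : 0 < p) {ε : ℝ} (hε : 0 < ε) :
    ∃ C : ℝ, 0 ≤ C ∧ ∀ (n m : ℕ), 0 < n → 0 < m → ∀ G : SimpleGraph (Fin n),
      degPowerSum p G / (n : ℝ) ^ (p + 1) ≤ phiClique r p m / (m : ℝ) ^ (p + 1) +
        (m : ℝ) ^ (r + 1) * cliqueDensity (r + 1) G + ε + C / m := by
  obtain ⟨C, hC, h⟩ := exists_meanDegreePow_le_expect hp hε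
  refine ⟨C, hC, fun n m hn hm G => ?_⟩
  have h1 := h n m hn hm (adjWeight G) (adjWeight_mem_Icc G)
  have h2 : 𝔼 x : Fin m → Fin n, meanDegreePow p (fun a b => adjWeight G (x a) (x b)) ≤ _ :=
    expect_meanDegreePow_le (r := r) hn hm hp G
  rw [meanDegreePow_adjWeight p hn] at h1
  linarith

theorem stmt14 (r : ℕ) (hr : 2 ≤ r) {W : Type*} [Fintype W] (H : SimpleGraph W)
    (hchrom : H.chromaticNumber = (r + 1 : ℕ)) (p : ℝ) (hp : 0 < p) :
    Filter.Tendsto (fun n : ℕ => (phiForb H p n - phiClique r p n) / (n : ℝ) ^ (p + 1))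
      Filter.atTop (nhds 0) := by
  have hcol : H.Colorable (r + 1) := SimpleGraph.chromaticNumber_le_iff_colorable.1 hchrom.le
  have hncol : ¬ H.Colorable r := fun h => by
    have h1 := SimpleGraph.chromaticNumber_le_iff_colorable.2 h
    rw [hchrom, Nat.cast_le] at h1
    omega
  rw [Metric.tendsto_atTop]
  intro ε hε
  obtain ⟨C, hC, hcomp⟩ := exists_degPowerSum_le (r := r) hp (show 0 < ε / 6 by positivity)
  obtain ⟨m, hm⟩ := exists_nat_gt (C / (ε / 6))
  have hm0 : 0 < m := by
    have : (0 : ℝ) < m := lt_of_le_of_lt (by positivity) hm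
    exact_mod_cast this
  have hsmall (n : ℕ) (hn : m ≤ n) : C / n ≤ ε / 6 := by
    have hn0 : (0 : ℝ) < n := by exact_mod_cast hm0.trans_le hn
    have hmn : (m : ℝ) ≤ n := by exact_mod_cast hn
    rw [div_lt_iff₀ (by positivity)] at hm
    rw [div_le_iff₀ hn0]
    nlinarith
  have hmk : (0 : ℝ) < (m : ℝ) ^ (r + 1) := by positivity
  obtain ⟨N, hN⟩ := exists_cliqueDensity_lt hcol (show 0 < ε / 6 / (m : ℝ) ^ (r + 1) by positivity)
  refine ⟨max N m, fun n hn => ?_⟩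
  have hmn : m ≤ n := (le_max_right N m).trans hn
  have hn0 : 0 < n := hm0.trans_le hmn
  have hnp : (0 : ℝ) < (n : ℝ) ^ (p + 1) := by positivity
  have hmp : (0 : ℝ) < (m : ℝ) ^ (p + 1) := by positivity
  have hlow : phiClique r p m / (m : ℝ) ^ (p + 1) ≤
      phiClique r p n / (n : ℝ) ^ (p + 1) + ε / 6 + ε / 6 := by
    rw [div_le_iff₀ hmp]
    refine Real.sSup_le ?_ ?_
    · rintro _ ⟨G, hG, rfl⟩
      rw [← div_le_iff₀ hmp]
      have h := hcomp m n hm0 hn0 G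
      rw [cliqueDensity_eq_zero hG, mul_zero, add_zero] at h
      linarith [hsmall n hmn]
    · have := phiClique_nonneg r p n
      positivity
  have hup : phiForb H p n ≤ (phiClique r p n / (n : ℝ) ^ (p + 1) + 5 * (ε / 6)) *
      (n : ℝ) ^ (p + 1) := by
    refine Real.sSup_le ?_ ?_
    · rintro _ ⟨G, hG, rfl⟩
      rw [← div_le_iff₀ hnp]
      have h := hcomp n m hn0 hm0 G
      have h1 := hN n ((le_max_left N m).trans hn) hn0 G hG
      rw [lt_div_iff₀' hmk] at h1
      linarith [hsmall m le_rfl]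
    · have := phiClique_nonneg r p n
      positivity
  rw [← div_le_iff₀ hnp] at hup
  have hge : 0 ≤ (phiForb H p n - phiClique r p n) / (n : ℝ) ^ (p + 1) :=
    div_nonneg (sub_nonneg.2 (phiClique_le_phiForb hncol hp n)) hnp.le
  rw [Real.dist_0_eq_abs, abs_of_nonneg hge, sub_div]
  linarith
end
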